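/- Let S be a measurable space and u : S × S → [0,∞) measurable. Assume the symmetrized squared kernel is positive definite in the sense that ∫∫ (u(x,y)+u(y,x))² dν(x) dν(y) ≥ 0 for every finite signed Borel measure ν on S for which this integral converges absolutely. For such ν set ‖ν‖_{(2)} = (∫∫ (u(x,y)+u(y,x))² d|ν|(x) d|ν|(y))^{1/2}, where |ν| is the total variation measure. Then for every k ≥ 2 and all finite signed Borel measures ν_1, …, ν_k with ‖ν_j‖_{(2)} < ∞, one has |∫⋯∫ u(y_1,y_2) u(y_2,y_3) ⋯ u(y_{k−1},y_k) u(y_k,y_1) ∏_{j=1}^k dν_j(y_j)| ≤ ∏_{j=1}^k ‖ν_j‖_{(2)}. -/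

import Mathlib

open MeasureTheory ENNReal

open scoped NNReal

/-- A kernel `K` is positive definite if its energy is nonnegative on every signed measure `g • ρ`,
with `ρ` finite and `|g| = 1`, against which it converges absolutely. -/
def PosDefKernel {S : Type*} [MeasurableSpace S] (K : S × S → ℝ) : Prop :=
  ∀ (ρ : Measure S) [IsFiniteMeasure ρ], ∀ g : S → ℝ, Measurable g → (∀ x, |g x| = 1) →
    Integrable K (ρ.prod ρ) → 0 ≤ ∫ q : S × S, K q * g q.1 * g q.2 ∂ρ.prod ρ

section Energy

variable {S : Type*} [MeasurableSpace S]

lemma exists_density_of_le {μ ρ : Measure S} [IsFiniteMeasure ρ] [IsFiniteMeasure μ] (h : μ ≤ ρ) :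
    ∃ p : S → ℝ≥0, Measurable p ∧ (∀ x, p x ≤ 1) ∧ ρ.withDensity (fun x => (p x : ℝ≥0∞)) = μ := by
  refine ⟨fun x => min (μ.rnDeriv ρ x).toNNReal 1, by fun_prop, fun x => min_le_right _ _, ?_⟩
  conv_rhs => rw [← Measure.withDensity_rnDeriv_eq μ ρ (Measure.absolutelyContinuous_of_le h)]
  refine withDensity_congr_ae ?_
  filter_upwards [Measure.rnDeriv_le_one_of_le h] with x hx
  have hx' : μ.rnDeriv ρ x ≤ 1 := hx
  have hx'' : (μ.rnDeriv ρ x).toNNReal ≤ 1 := by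
    simpa using ENNReal.toNNReal_mono ENNReal.one_ne_top hx'
  rw [min_eq_left hx'', ENNReal.coe_toNNReal (ne_top_of_le_ne_top ENNReal.one_ne_top hx')]

lemma integral_prod_withDensity {ρ : Measure S} [IsFiniteMeasure ρ] {p q : S → ℝ≥0}
    (hp : Measurable p) (hq : Measurable q) (F : S × S → ℝ) :
    ∫ z, F z ∂(ρ.withDensity fun x => (p x : ℝ≥0∞)).prod (ρ.withDensity fun x => (q x : ℝ≥0∞))
      = ∫ z : S × S, p z.1 * q z.2 * F z ∂ρ.prod ρ := by
  rw [prod_withDensity (by fun_prop) (by fun_prop)]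
  have := integral_withDensity_eq_integral_smul (μ := ρ.prod ρ)
    (f := fun z : S × S => p z.1 * q z.2) (by fun_prop) F
  simpa [NNReal.smul_def] using this

lemma PosDefKernel.integral_mul_mul_nonneg {K : S × S → ℝ} (hK : PosDefKernel K)
    {ρ : Measure S} [IsFiniteMeasure ρ] (hint : Integrable K (ρ.prod ρ))
    {φ : S → ℝ} (hφ : Measurable φ) {C : ℝ} (hC : ∀ x, |φ x| ≤ C) :
    0 ≤ ∫ z : S × S, K z * φ z.1 * φ z.2 ∂ρ.prod ρ := by
  have hp : Measurable fun x => ‖φ x‖₊ := by fun_prop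
  have hC' : ∀ x, (‖φ x‖₊ : ℝ≥0∞) ≤ C.toNNReal := fun x => by
    rw [ENNReal.coe_le_coe]
    exact NNReal.le_toNNReal_of_coe_le (by simpa using hC x)
  have : IsFiniteMeasure (ρ.withDensity fun x => (‖φ x‖₊ : ℝ≥0∞)) := by
    refine isFiniteMeasure_withDensity (ne_of_lt ?_)
    calc ∫⁻ x, (‖φ x‖₊ : ℝ≥0∞) ∂ρ ≤ ∫⁻ _, (C.toNNReal : ℝ≥0∞) ∂ρ := lintegral_mono hC'
      _ < ∞ := by
        rw [lintegral_const]
        exact ENNReal.mul_lt_top ENNReal.coe_lt_top (measure_lt_top _ _)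
  set g : S → ℝ := fun x => if 0 ≤ φ x then 1 else -1 with hg
  have hgm : Measurable g :=
    Measurable.ite (measurableSet_le measurable_const hφ) measurable_const measurable_const
  have hgφ : ∀ x, ‖φ x‖ * g x = φ x := fun x => by
    by_cases h : 0 ≤ φ x
    · simp [hg, h, abs_of_nonneg h]
    · simp [hg, h, abs_of_neg (not_le.1 h)]
  have hK' := hK (ρ.withDensity fun x => (‖φ x‖₊ : ℝ≥0∞)) g hgm
    (fun x => by by_cases h : 0 ≤ φ x <;> simp [hg, h]) ?_
  · rw [integral_prod_withDensity hp hp] at hK'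
    refine hK'.trans_eq (integral_congr_ae (.of_forall fun z => ?_))
    simp only [coe_nnnorm]
    rw [← hgφ z.1, ← hgφ z.2]
    simp only [norm_mul, norm_norm]
    have h1 : ‖g z.1‖ = 1 := by by_cases h : 0 ≤ φ z.1 <;> simp [hg, h]
    have h2 : ‖g z.2‖ = 1 := by by_cases h : 0 ≤ φ z.2 <;> simp [hg, h]
    rw [h1, h2]
    ring
  · rw [prod_withDensity (by fun_prop) (by fun_prop)]
    have := (integrable_withDensity_iff_integrable_smul (μ := ρ.prod ρ)
      (f := fun z : S × S => ‖φ z.1‖₊ * ‖φ z.2‖₊) (by fun_prop) (g := K)).2 ?_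
    · simpa using this
    · simp only [NNReal.smul_def, smul_eq_mul, NNReal.coe_mul, coe_nnnorm]
      refine hint.bdd_mul (c := C * C) (by fun_prop) (.of_forall fun z => ?_)
      rw [norm_mul, norm_norm, norm_norm]
      exact mul_le_mul (hC _) (hC _) (norm_nonneg _) ((abs_nonneg _).trans (hC z.1))

/-- Cauchy-Schwarz inequality for the mutual energy of two measures. -/
lemma PosDefKernel.integral_prod_sq_le {K : S × S → ℝ} (hK : PosDefKernel K)
    (hsymm : ∀ z, K z.swap = K z) {μ ν : Measure S} [IsFiniteMeasure μ] [IsFiniteMeasure ν]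
    (hint : Integrable K ((μ + ν).prod (μ + ν))) :
    (∫ z, K z ∂μ.prod ν) ^ 2 ≤ (∫ z, K z ∂μ.prod μ) * ∫ z, K z ∂ν.prod ν := by
  obtain ⟨p, hp, hp1, hpμ⟩ := exists_density_of_le (Measure.le_add_right (le_refl μ) : μ ≤ μ + ν)
  obtain ⟨q, hq, hq1, hqν⟩ := exists_density_of_le (Measure.le_add_left (le_refl ν) : ν ≤ μ + ν)
  have hbd : ∀ {r s : S → ℝ≥0}, Measurable r → Measurable s → (∀ x, r x ≤ 1) → (∀ x, s x ≤ 1) →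
      Integrable (fun z : S × S => (r z.1 : ℝ) * s z.2 * K z) ((μ + ν).prod (μ + ν)) := by
    intro r s hr hs hr1 hs1
    refine hint.bdd_mul (c := 1) (by fun_prop) (.of_forall fun z => ?_)
    rw [Real.norm_of_nonneg (by positivity)]
    exact_mod_cast mul_le_one' (hr1 _) (hs1 _)
  have hswap : ∫ z, K z ∂ν.prod μ = ∫ z, K z ∂μ.prod ν := by
    rw [← integral_prod_swap (μ := μ) (ν := ν) K]
    simp_rw [hsymm]
  have key : ∀ a : ℝ, 0 ≤ (∫ z, K z ∂μ.prod μ) * (a * a) + (-2 * ∫ z, K z ∂μ.prod ν) * a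
      + ∫ z, K z ∂ν.prod ν := by
    intro a
    have h0 := hK.integral_mul_mul_nonneg hint (φ := fun x => a * p x - q x) (by fun_prop)
      (C := |a| + 1) (fun x => by
        refine (abs_sub _ _).trans (add_le_add ?_ ?_)
        · rw [abs_mul, NNReal.abs_eq]
          exact mul_le_of_le_one_right (abs_nonneg _) (hp1 x)
        · rw [NNReal.abs_eq]
          exact hq1 x)
    have h1 : ∫ z : S × S, K z * (a * p z.1 - q z.1) * (a * p z.2 - q z.2) ∂(μ + ν).prod (μ + ν)
        = a * a * (∫ z, K z ∂μ.prod μ) - a * (∫ z, K z ∂μ.prod ν) - a * (∫ z, K z ∂ν.prod μ)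
          + ∫ z, K z ∂ν.prod ν := by
      have e1 := integral_prod_withDensity (ρ := μ + ν) hp hp K
      have e2 := integral_prod_withDensity (ρ := μ + ν) hp hq K
      have e3 := integral_prod_withDensity (ρ := μ + ν) hq hp K
      have e4 := integral_prod_withDensity (ρ := μ + ν) hq hq K
      simp only [hpμ, hqν] at e1 e2 e3 e4
      have i1 := (hbd hp hp hp1 hp1).const_mul (a * a)
      have i2 := (hbd hp hq hp1 hq1).const_mul a
      have i3 := (hbd hq hp hq1 hp1).const_mul a
      have i4 := hbd hq hq hq1 hq1
      rw [e1, e2, e3, e4, ← integral_const_mul, ← integral_const_mul, ← integral_const_mul,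
        ← integral_sub i1 i2, ← integral_sub (by exact i1.sub i2) i3,
        ← integral_add (by exact (i1.sub i2).sub i3) i4]
      refine integral_congr_ae (.of_forall fun z => ?_)
      ring
    rw [h1, hswap] at h0
    linarith
  have := discrim_le_zero key
  rw [discrim] at this
  nlinarith

lemma PosDefKernel.sq_le_mul_diag {K : S × S → ℝ} (hK : PosDefKernel K)
    (hmeas : Measurable K) (hsymm : ∀ z, K z.swap = K z) (a b : S) :
    K (a, b) ^ 2 ≤ K (a, a) * K (b, b) := by
  have hd : ∀ x y : S, Integrable K ((Measure.dirac x).prod (Measure.dirac y)) := fun x y => by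
    rw [Measure.dirac_prod_dirac]
    refine ⟨hmeas.aestronglyMeasurable, ?_⟩
    rw [hasFiniteIntegral_iff_enorm, lintegral_dirac' _ (by fun_prop)]
    exact enorm_lt_top
  have := hK.integral_prod_sq_le hsymm (μ := .dirac a) (ν := .dirac b) (by
    rw [Measure.prod_add, Measure.add_prod, Measure.add_prod]
    exact ((hd a a).add_measure (hd b a)).add_measure ((hd a b).add_measure (hd b b)))
  simpa only [Measure.dirac_prod_dirac, integral_dirac' _ _ hmeas.stronglyMeasurable] using this

/-- The mutual energy of two measures of finite energy is finite and bounded by the geometric mean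
of their energies. -/
lemma PosDefKernel.lintegral_prod_le {K : S × S → ℝ} (hK : PosDefKernel K)
    (hmeas : Measurable K) (hnonneg : ∀ z, 0 ≤ K z) (hsymm : ∀ z, K z.swap = K z)
    {μ ν : Measure S} [IsFiniteMeasure μ] [IsFiniteMeasure ν]
    (hμ : Integrable K (μ.prod μ)) (hν : Integrable K (ν.prod ν)) :
    ∫⁻ z, ENNReal.ofReal (K z) ∂μ.prod ν
      ≤ ENNReal.ofReal (√(∫ z, K z ∂μ.prod μ) * √(∫ z, K z ∂ν.prod ν)) := by
  set A : ℕ → Set S := fun n => {x | K (x, x) ≤ n} with hA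
  have hAm : ∀ n, MeasurableSet (A n) := fun n => measurableSet_le (by fun_prop) measurable_const
  have hmono : Monotone A := fun m n hmn x (hx : K (x, x) ≤ m) =>
    hx.trans (by exact_mod_cast hmn)
  have hun : ⋃ n, A n ×ˢ A n = Set.univ := by
    refine Set.eq_univ_of_forall fun z => Set.mem_iUnion.2 ?_
    obtain ⟨m, hm⟩ := exists_nat_ge (K (z.1, z.1))
    obtain ⟨n, hn⟩ := exists_nat_ge (K (z.2, z.2))
    exact ⟨max m n, hmono (le_max_left m n) hm, hmono (le_max_right m n) hn⟩
  rw [← setLIntegral_univ, ← hun, setLIntegral_iUnion_of_directed _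
    (Monotone.directed_le fun m n hmn => Set.prod_mono (hmono hmn) (hmono hmn))]
  refine iSup_le fun n => ?_
  have hbd : ∀ (μ' ν' : Measure S) [IsFiniteMeasure μ'] [IsFiniteMeasure ν'],
      Integrable K ((μ'.restrict (A n)).prod (ν'.restrict (A n))) := by
    intro μ' ν' _ _
    refine Integrable.of_bound hmeas.aestronglyMeasurable (n : ℝ) ?_
    rw [Measure.prod_restrict]
    refine (ae_restrict_iff' ((hAm n).prod (hAm n))).2 (.of_forall fun z hz => ?_)
    rw [Real.norm_of_nonneg (hnonneg z)]
    refine abs_le_of_sq_le_sq' ((hK.sq_le_mul_diag hmeas hsymm z.1 z.2).trans ?_)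
      (Nat.cast_nonneg n) |>.2
    rw [sq]
    exact mul_le_mul hz.1 hz.2 (hnonneg _) (Nat.cast_nonneg n)
  have hle : ∀ {μ' : Measure S} [IsFiniteMeasure μ'], Integrable K (μ'.prod μ') →
      ∫ z, K z ∂(μ'.restrict (A n)).prod (μ'.restrict (A n)) ≤ ∫ z, K z ∂μ'.prod μ' := by
    intro μ' _ h
    exact integral_mono_measure (Measure.prod_mono Measure.restrict_le_self
      Measure.restrict_le_self) (.of_forall hnonneg) h
  rw [← Measure.prod_restrict, ← ofReal_integral_eq_lintegral_ofReal (hbd μ ν)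
    (.of_forall hnonneg)]
  refine ENNReal.ofReal_le_ofReal ?_
  rw [← Real.sqrt_mul (integral_nonneg hnonneg)]
  refine Real.le_sqrt_of_sq_le ((hK.integral_prod_sq_le hsymm ?_).trans ?_)
  · rw [← Measure.restrict_add]
    exact hbd (μ + ν) (μ + ν)
  · exact mul_le_mul (hle hμ) (hle hν) (integral_nonneg hnonneg) (integral_nonneg hnonneg)

end Energy

section Cycle

lemma sq_lintegral_mul_le {α : Type*} [MeasurableSpace α] (μ : Measure α) {f g : α → ℝ≥0∞}
    (hf : Measurable f) (hg : Measurable g) :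
    (∫⁻ x, f x * g x ∂μ) ^ 2 ≤ (∫⁻ x, f x ^ 2 ∂μ) * ∫⁻ x, g x ^ 2 ∂μ := by
  have h := ENNReal.lintegral_mul_le_Lp_mul_Lq μ Real.HolderConjugate.two_two
    hf.aemeasurable hg.aemeasurable
  simp only [Pi.mul_apply, ENNReal.rpow_two] at h
  calc (∫⁻ x, f x * g x ∂μ) ^ 2 ≤ _ := pow_le_pow_left' h 2
    _ = _ := by
      rw [mul_pow, ← ENNReal.rpow_mul_natCast, ← ENNReal.rpow_mul_natCast]
      norm_num

variable {S : Type*} [MeasurableSpace S]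

/-- The Hilbert-Schmidt norm is submultiplicative. -/
lemma lintegral_sq_comp_le {μ₁ μ₂ μ₃ : Measure S} [SFinite μ₁] [SFinite μ₂] [SFinite μ₃]
    {v w : S × S → ℝ≥0∞} (hv : Measurable v) (hw : Measurable w) :
    ∫⁻ q : S × S, (∫⁻ z, v (q.1, z) * w (z, q.2) ∂μ₂) ^ 2 ∂μ₁.prod μ₃
      ≤ (∫⁻ q, v q ^ 2 ∂μ₁.prod μ₂) * ∫⁻ q, w q ^ 2 ∂μ₂.prod μ₃ := by
  calc ∫⁻ q : S × S, (∫⁻ z, v (q.1, z) * w (z, q.2) ∂μ₂) ^ 2 ∂μ₁.prod μ₃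
      ≤ ∫⁻ q : S × S, (∫⁻ z, v (q.1, z) ^ 2 ∂μ₂) * ∫⁻ z, w (z, q.2) ^ 2 ∂μ₂ ∂μ₁.prod μ₃ :=
        lintegral_mono fun q => sq_lintegral_mul_le μ₂ (by fun_prop) (by fun_prop)
    _ = (∫⁻ x, ∫⁻ z, v (x, z) ^ 2 ∂μ₂ ∂μ₁) * ∫⁻ y, ∫⁻ z, w (z, y) ^ 2 ∂μ₂ ∂μ₃ :=
        lintegral_prod_mul (f := fun x => ∫⁻ z, v (x, z) ^ 2 ∂μ₂)
          (g := fun y => ∫⁻ z, w (z, y) ^ 2 ∂μ₂)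
          (Measurable.lintegral_prod_right' (f := fun p : S × S => v p ^ 2)
            (by fun_prop)).aemeasurable
          (Measurable.lintegral_prod_left' (f := fun p : S × S => w p ^ 2)
            (by fun_prop)).aemeasurable
    _ = _ := by
        rw [lintegral_prod _ (by fun_prop), lintegral_prod_symm _ (by fun_prop)]

/-- Integrating out the first vertex of a cyclic product of kernels. -/
lemma lintegral_pi_cycle_succ {n : ℕ} (μ : Fin (n + 2) → Measure S) [∀ j, IsFiniteMeasure (μ j)]
    {w : Fin (n + 1) → S × S → ℝ≥0∞} (hw : ∀ i, Measurable (w i))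
    {v : S × S → ℝ≥0∞} (hv : Measurable v) :
    ∫⁻ y, (∏ i : Fin (n + 1), w i (y i.castSucc, y i.succ)) * v (y (Fin.last _), y 0)
        ∂Measure.pi μ
      = ∫⁻ y, (∏ i : Fin n, w i.succ (y i.castSucc, y i.succ)) *
          (∫⁻ z, v (y (Fin.last _), z) * w 0 (z, y 0) ∂μ 0) ∂Measure.pi fun j => μ j.succ := by
  have hmp := (measurePreserving_piFinSuccAbove μ 0).symm
  rw [← hmp.lintegral_comp (by fun_prop), lintegral_prod_symm _ (by fun_prop)]
  refine lintegral_congr fun y => ?_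
  rw [← lintegral_const_mul _ (by fun_prop)]
  refine lintegral_congr fun z => ?_
  simp only [MeasurableEquiv.piFinSuccAbove_symm_apply, Fin.insertNthEquiv_zero,
    Fin.consEquiv_apply, Fin.prod_univ_succ, Fin.cons_succ, Fin.castSucc_zero, Fin.cons_zero,
    ← Fin.succ_castSucc, ← Fin.succ_last]
  ring

/-- The Cauchy-Schwarz bound for a cyclic product of kernels. -/
lemma sq_lintegral_pi_cycle_le {n : ℕ} (μ : Fin (n + 2) → Measure S)
    [∀ j, IsFiniteMeasure (μ j)] {w : Fin (n + 1) → S × S → ℝ≥0∞} (hw : ∀ i, Measurable (w i))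
    {v : S × S → ℝ≥0∞} (hv : Measurable v) :
    (∫⁻ y, (∏ i : Fin (n + 1), w i (y i.castSucc, y i.succ)) * v (y (Fin.last _), y 0)
        ∂Measure.pi μ) ^ 2
      ≤ (∏ i : Fin (n + 1), ∫⁻ q, w i q ^ 2 ∂(μ i.castSucc).prod (μ i.succ)) *
          ∫⁻ q, v q ^ 2 ∂(μ (Fin.last _)).prod (μ 0) := by
  induction n generalizing v with
  | zero =>
    have hmp := (measurePreserving_piFinTwo μ).symm
    rw [← hmp.lintegral_comp (by fun_prop)]
    have h := sq_lintegral_mul_le ((μ 0).prod (μ 1)) (hw 0) (g := fun q => v q.swap) (by fun_prop)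
    have hs : ∫⁻ q : S × S, v q.swap ^ 2 ∂(μ 0).prod (μ 1) = ∫⁻ q, v q ^ 2 ∂(μ 1).prod (μ 0) :=
      lintegral_prod_swap (fun q => v q ^ 2)
    rw [hs] at h
    simpa [MeasurableEquiv.piFinTwo, Prod.swap] using h
  | succ n ih =>
    rw [lintegral_pi_cycle_succ μ hw hv]
    have hv' : Measurable fun q : S × S => ∫⁻ z, v (q.1, z) * w 0 (z, q.2) ∂μ 0 :=
      Measurable.lintegral_prod_right' (f := fun p : (S × S) × S =>
        v (p.1.1, p.2) * w 0 (p.2, p.1.2)) (by fun_prop)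
    refine (ih (fun j => μ j.succ) (fun i => hw i.succ) hv').trans
      ((mul_le_mul' le_rfl (lintegral_sq_comp_le hv (hw 0))).trans_eq ?_)
    rw [Fin.prod_univ_succ (fun i => ∫⁻ q, w i q ^ 2 ∂(μ i.castSucc).prod (μ i.succ))]
    have hring : ∀ a b c : ℝ≥0∞, a * (b * c) = c * a * b := fun a b c => by ring
    exact hring _ _ _

end Cycle

/-- Item 5 of Theorem 6.2: if the symmetrized squared kernel `(u(x,y)+u(y,x))²` of a
nonnegative kernel `u` is positive definite (i.e. `∫∫ (u(x,y)+u(y,x))² dν dν ≥ 0` for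
every finite signed measure `ν = g • ρ`, `|g| = 1`, for which the integral converges
absolutely), then `‖ν‖_{(2)} = (∫∫ (u(x,y)+u(y,x))² d|ν| d|ν|)^{1/2}` is a proper norm:
for `k ≥ 2` and signed measures `ν j = f j • μ j` (with `|f j| = 1`, so `|ν j| = μ j`)
of finite `‖·‖_{(2)}`-norm, with `y (k+1) = y 1`,
`|∫⋯∫ u(y₁,y₂)⋯u(y_k,y₁) ∏ dν_j| ≤ ∏_j ‖ν_j‖_{(2)}`. -/
theorem stmt_8 {S : Type*} [MeasurableSpace S]
    (u : S → S → ℝ) (hu_meas : Measurable (Function.uncurry u))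
    (hu_nonneg : ∀ x y, 0 ≤ u x y)
    (hpd : ∀ (ρ : Measure S) [IsFiniteMeasure ρ], ∀ g : S → ℝ, Measurable g →
      (∀ x, |g x| = 1) →
      Integrable (fun q : S × S => (u q.1 q.2 + u q.2 q.1) ^ 2) (ρ.prod ρ) →
      0 ≤ ∫ q : S × S, (u q.1 q.2 + u q.2 q.1) ^ 2 * g q.1 * g q.2 ∂ρ.prod ρ)
    (k : ℕ) (hk : 2 ≤ k) [NeZero k]
    (μ : Fin k → Measure S) [∀ j, IsFiniteMeasure (μ j)]
    (f : Fin k → S → ℝ) (hf_meas : ∀ j, Measurable (f j)) (hf : ∀ j x, |f j x| = 1)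
    (hfin : ∀ j, Integrable (fun q : S × S => (u q.1 q.2 + u q.2 q.1) ^ 2)
      ((μ j).prod (μ j))) :
    |∫ y : Fin k → S, (∏ j, u (y j) (y (j + 1))) * ∏ j, f j (y j) ∂Measure.pi μ|
      ≤ ∏ j, Real.sqrt (∫ q : S × S, (u q.1 q.2 + u q.2 q.1) ^ 2 ∂(μ j).prod (μ j)) := by
  obtain ⟨n, rfl⟩ : ∃ n, k = n + 2 := ⟨k - 2, by omega⟩
  set K : S × S → ℝ := fun q => (u q.1 q.2 + u q.2 q.1) ^ 2 with hKdef
  have hu2 : Measurable fun q : S × S => u q.1 q.2 := hu_meas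
  have hu2' : Measurable fun q : S × S => u q.2 q.1 := hu2.comp measurable_swap
  have hKm : Measurable K := (hu2.add hu2').pow_const 2
  have hK0 : ∀ z, 0 ≤ K z := fun z => sq_nonneg _
  have hKsymm : ∀ z, K z.swap = K z := fun z => by simp [hKdef, add_comm]
  have hK : PosDefKernel K := hpd
  set w : S × S → ℝ≥0∞ := fun q => ENNReal.ofReal (u q.1 q.2) with hw
  have hwm : Measurable w := hu2.ennreal_ofReal
  set s : Fin (n + 2) → ℝ := fun j => √(∫ q, K q ∂(μ j).prod (μ j)) with hs
  have hs0 : ∀ j, 0 ≤ s j := fun j => Real.sqrt_nonneg _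
  have hedge : ∀ i j, ∫⁻ q, w q ^ 2 ∂(μ i).prod (μ j) ≤ ENNReal.ofReal (s i * s j) := fun i j => by
    refine (lintegral_mono fun q => ?_).trans
      (hK.lintegral_prod_le hKm hK0 hKsymm (hfin i) (hfin j))
    rw [hw, ← ENNReal.ofReal_pow (hu_nonneg _ _)]
    exact ENNReal.ofReal_le_ofReal (pow_le_pow_left₀ (hu_nonneg _ _)
      (le_add_of_nonneg_right (hu_nonneg _ _)) 2)
  have hcycle : (∫⁻ y, ∏ j, w (y j, y (j + 1)) ∂Measure.pi μ) ^ 2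
      ≤ ENNReal.ofReal (∏ j, s j) ^ 2 := by
    have hsplit : ∀ y : Fin (n + 2) → S, ∏ j, w (y j, y (j + 1))
        = (∏ i : Fin (n + 1), w (y i.castSucc, y i.succ)) * w (y (Fin.last _), y 0) := fun y => by
      rw [Fin.prod_univ_castSucc, Fin.last_add_one]
      simp_rw [Fin.coeSucc_eq_succ]
    simp_rw [hsplit]
    calc _ ≤ _ := sq_lintegral_pi_cycle_le μ (w := fun _ => w) (fun _ => hwm) hwm
      _ ≤ (∏ i : Fin (n + 1), ENNReal.ofReal (s i.castSucc * s i.succ))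
          * ENNReal.ofReal (s (Fin.last _) * s 0) :=
        mul_le_mul' (Finset.prod_le_prod' fun i _ => hedge _ _) (hedge _ _)
      _ = ENNReal.ofReal (∏ j, s j) ^ 2 := by
        rw [← ENNReal.ofReal_prod_of_nonneg fun i _ => mul_nonneg (hs0 _) (hs0 _),
          ← ENNReal.ofReal_mul (Finset.prod_nonneg fun i _ => mul_nonneg (hs0 _) (hs0 _)),
          ← ENNReal.ofReal_pow (Finset.prod_nonneg fun i _ => hs0 _), Finset.prod_mul_distrib, sq]
        conv_rhs => rw [Fin.prod_univ_castSucc]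
        conv_rhs => enter [1, 2]; rw [← Fin.prod_univ_castSucc, Fin.prod_univ_succ]
        ring_nf
  have hcycle' := (ENNReal.pow_right_strictMono two_ne_zero).le_iff_le.1 hcycle
  rw [← Real.norm_eq_abs]
  refine (norm_integral_le_lintegral_norm _).trans
    (ENNReal.toReal_le_of_le_ofReal (Finset.prod_nonneg fun j _ => hs0 j)
      (le_of_eq_of_le (lintegral_congr fun y => ?_) hcycle'))
  have hf1 : ∀ j, ‖f j (y j)‖ = 1 := fun j => hf j (y j)
  rw [norm_mul, norm_prod, norm_prod, Finset.prod_congr rfl fun j _ => hf1 j, Finset.prod_const_one,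
    mul_one, ENNReal.ofReal_prod_of_nonneg fun j _ => norm_nonneg _]
  exact Finset.prod_congr rfl fun j _ => by rw [Real.norm_of_nonneg (hu_nonneg _ _)]
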